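/- arXiv:2004.07335 — 3 statements merged into one kernel-verified Lean document; each statement's English description precedes it below -/
import Mathlib

section
/- Let a be a positive integer and b a prime number with a < b. Then for every integer n ≥ b + 1, we have lcm(a, a+b, a+2b, …, a+nb) ≤ (12.30641 · b^(b/(b-1)))^n. -/
/-- `L a b n` is the least common multiple of `a, a+b, a+2b, …, a+nb`. -/
def L (a b n : ℕ) : ℕ := Finset.lcm (Finset.range (n + 1)) (fun k => a + k * b)

open Finset

theorem lcmUpto_add_dvd {m k : ℕ} (hmk : m ≤ k) :
    Nat.lcmUpto (m + k) ∣ Nat.lcmUpto k * (m + k).choose k := by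
  have hc : (m + k).choose k ≠ 0 := (Nat.choose_pos (Nat.le_add_left k m)).ne'
  rw [← Nat.factorization_prime_le_iff_dvd (Nat.lcmUpto_ne_zero _)
    (mul_ne_zero (Nat.lcmUpto_ne_zero _) hc)]
  intro p hp
  rw [Nat.factorization_mul (Nat.lcmUpto_ne_zero _) hc, Finsupp.add_apply,
    Nat.factorization_lcmUpto _ hp, Nat.factorization_lcmUpto _ hp,
    Nat.factorization_choose' hp (Nat.lt_succ_self _)]
  have hsub : Ico (Nat.log p k + 1) (Nat.log p (m + k) + 1) ⊆
      {i ∈ Ico 1 (Nat.log p (m + k) + 1) | p ^ i ≤ k % p ^ i + m % p ^ i} := by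
    intro i hi
    rw [mem_Ico] at hi
    have h1 : k < p ^ i := Nat.lt_pow_of_log_lt hp.one_lt (by lia)
    have h2 : p ^ i ≤ m + k := by
      rcases Nat.eq_zero_or_pos (m + k) with h | h
      · simp [h] at hi
        lia
      · exact Nat.pow_le_of_le_log h.ne' (by lia)
    rw [mem_filter, mem_Ico, Nat.mod_eq_of_lt h1, Nat.mod_eq_of_lt (hmk.trans_lt h1)]
    lia
  have := card_le_card hsub
  rw [Nat.card_Ico] at this
  lia

theorem lcmUpto_le_four_pow (n : ℕ) : Nat.lcmUpto n ≤ 4 ^ n := by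
  induction n using Nat.strong_induction_on with | h n ih =>
  have step {m k : ℕ} (hmk : m ≤ k) (hm : 0 < m) (hn : n = m + k)
      (hc : (m + k).choose k ≤ 4 ^ m) : Nat.lcmUpto n ≤ 4 ^ n := by
    subst hn
    calc Nat.lcmUpto (m + k) ≤ Nat.lcmUpto k * (m + k).choose k :=
          Nat.le_of_dvd (Nat.mul_pos (Nat.lcmUpto_pos _) (Nat.choose_pos (by lia)))
            (lcmUpto_add_dvd hmk)
      _ ≤ 4 ^ k * 4 ^ m := Nat.mul_le_mul (ih k (by lia)) hc
      _ = 4 ^ (m + k) := by rw [← pow_add, add_comm]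
  rcases lt_or_ge n 2 with h | h
  · interval_cases n <;> simp [Nat.lcmUpto]
  obtain ⟨m, hm | hm⟩ := Nat.even_or_odd' n
  · refine step (le_refl m) (by lia) (by lia) ?_
    rw [← two_mul]
    exact Nat.centralBinom_le_four_pow m
  · refine step (Nat.le_succ m) (by lia) (by lia) ?_
    have := Nat.choose_middle_le_pow m
    rwa [Nat.choose_symm_of_eq_add (show 2 * m + 1 = m + (m + 1) by lia),
      show 2 * m + 1 = m + (m + 1) by lia] at this

theorem div_le_card_dvd_ap {a b q N : ℕ} (hq : 0 < q) (hqb : q.Coprime b) :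
    N / q ≤ #{k ∈ range N | q ∣ a + k * b} := by
  obtain ⟨c, hc⟩ : ∃ c, q ∣ a + c * b := by
    have : NeZero q := ⟨hq.ne'⟩
    refine ⟨(-(a : ZMod q) * (b : ZMod q)⁻¹).val, ?_⟩
    rw [← ZMod.natCast_eq_zero_iff]
    push_cast
    rw [ZMod.natCast_zmod_val, mul_assoc, mul_comm (b : ZMod q)⁻¹,
      ZMod.coe_mul_inv_eq_one b hqb.symm]
    ring
  have hcount := Nat.count_modEq_card N hq c
  rw [Nat.count_eq_card_filter_range] at hcount
  refine (show N / q ≤ #{k ∈ range N | k ≡ c [MOD q]} by rw [hcount]; exact Nat.le_add_right _ _).trans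
    (card_le_card ?_)
  intro k hk
  rw [mem_filter] at hk ⊢
  have : a + k * b ≡ a + c * b [MOD q] := (hk.2.mul_right b).add_left a
  exact ⟨hk.1, (this.dvd_iff dvd_rfl).2 hc⟩

theorem L_ne_zero {a : ℕ} (ha : 0 < a) (b n : ℕ) : L a b n ≠ 0 := by
  rw [L, Ne, Finset.lcm_eq_zero_iff]
  simp
  lia

theorem factorization_L_add_factorization_factorial_le {a b p : ℕ} (ha : 0 < a) (hp : p.Prime)
    (hpb : p.Coprime b) (n : ℕ) :
    (L a b n).factorization p + (n + 1).factorial.factorization p ≤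
      (∏ k ∈ range (n + 1), (a + k * b)).factorization p + Nat.log p (n + 1) := by
  have hne (k : ℕ) : a + k * b ≠ 0 := by lia
  obtain ⟨k₀, hk₀, hL⟩ : ∃ k ∈ range (n + 1), (L a b n).factorization p =
      (a + k * b).factorization p := by
    rw [L, Finset.factorization_lcm (fun k _ ↦ hne k)]
    exact exists_mem_eq_sup _ ⟨0, by simp⟩ _
  set B := a + n * b + n + 2
  have hB {x : ℕ} (hx : x < B) : x < p ^ B := hx.trans (Nat.lt_pow_self hp.one_lt)
  have hv {k : ℕ} (hk : k ∈ range (n + 1)) :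
      (a + k * b).factorization p = ∑ i ∈ Ico 1 B, if p ^ i ∣ a + k * b then 1 else 0 := by
    rw [Nat.factorization_eq_card_pow_dvd_of_lt hp (Nat.pos_of_ne_zero (hne k)) (hB ?_),
      card_filter]
    have : k * b ≤ n * b := Nat.mul_le_mul_right b (by rw [mem_range] at hk; lia)
    lia
  have hlog : Nat.log p (n + 1) < B := (Nat.log_le_self _ _).trans_lt (by lia)
  have hlog' : Nat.log p (n + 1) = ∑ i ∈ Ico 1 B, if p ^ i ≤ n + 1 then 1 else 0 := by
    rw [← card_filter]
    have : {i ∈ Ico 1 B | p ^ i ≤ n + 1} = Ico 1 (Nat.log p (n + 1) + 1) := by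
      ext i
      rw [mem_filter, mem_Ico, mem_Ico, ← Nat.le_log_iff_pow_le hp.one_lt (by lia)]
      lia
    rw [this, Nat.card_Ico, Nat.add_sub_cancel]
  rw [hL, hv hk₀, Nat.factorization_factorial hp hlog, Nat.factorization_prod fun k _ ↦ hne k,
    Finsupp.finsetSum_apply, sum_congr rfl fun k hk ↦ hv hk, sum_comm, hlog', ← sum_add_distrib,
    ← sum_add_distrib]
  refine sum_le_sum fun i _ ↦ ?_
  rw [← card_filter]
  have hcard := div_le_card_dvd_ap (a := a) (N := n + 1) (pow_pos hp.pos i) (hpb.pow_left i)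
  split_ifs with h1 h2 h2
  · lia
  · rw [Nat.div_eq_of_lt (not_le.1 h2), add_zero, add_zero]
    exact card_pos.2 ⟨k₀, mem_filter.2 ⟨hk₀, h1⟩⟩
  · lia
  · lia

theorem L_mul_factorial_dvd {a b : ℕ} (ha : 0 < a) (hb : b.Prime) (hab : a < b) (n : ℕ) :
    L a b n * (n + 1).factorial ∣
      (∏ k ∈ range (n + 1), (a + k * b)) * Nat.lcmUpto (n + 1) *
        b ^ (n + 1).factorial.factorization b := by
  have hL := L_ne_zero ha b n
  have hF := (n + 1).factorial_ne_zero
  have hne (k : ℕ) : a + k * b ≠ 0 := by lia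
  have hP : ∏ k ∈ range (n + 1), (a + k * b) ≠ 0 := prod_ne_zero_iff.2 fun k _ ↦ hne k
  have hU := Nat.lcmUpto_ne_zero (n + 1)
  have hB : b ^ (n + 1).factorial.factorization b ≠ 0 := pow_ne_zero _ hb.ne_zero
  rw [← Nat.factorization_prime_le_iff_dvd (mul_ne_zero hL hF) (mul_ne_zero (mul_ne_zero hP hU) hB)]
  intro p hp
  rw [Nat.factorization_mul hL hF, Nat.factorization_mul (mul_ne_zero hP hU) hB,
    Nat.factorization_mul hP hU]
  simp only [Finsupp.add_apply]
  rw [Nat.factorization_lcmUpto _ hp]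
  rcases eq_or_ne p b with rfl | hpb
  · have h0 : (L a p n).factorization p = 0 := by
      rw [L, Finset.factorization_lcm (fun k _ ↦ hne k)]
      refine le_antisymm (Finset.sup_le fun k _ ↦ ?_) (Nat.zero_le _)
      refine (Nat.factorization_eq_zero_of_not_dvd fun h ↦ ?_).le
      exact Nat.not_dvd_of_pos_of_lt ha hab ((Nat.dvd_add_left (dvd_mul_left p k)).1 h)
    rw [h0, hp.factorization_pow, Finsupp.single_eq_same]
    lia
  · have := factorization_L_add_factorization_factorial_le ha hp
      ((Nat.coprime_primes hp hb).2 hpb) n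
    lia

theorem L_le {a b : ℕ} (ha : 0 < a) (hb : b.Prime) (hab : a < b) (n : ℕ) :
    L a b n ≤ b ^ (n + 1) * 4 ^ (n + 1) * b ^ (n + 1).factorial.factorization b := by
  have hprod : ∏ k ∈ range (n + 1), (a + k * b) ≤ b ^ (n + 1) * (n + 1).factorial := by
    rw [← prod_range_add_one_eq_factorial]
    nth_rw 2 [← card_range (n + 1)]
    rw [← prod_const, ← prod_mul_distrib]
    exact prod_le_prod' fun k _ ↦ by nlinarith
  have hpos : 0 < (∏ k ∈ range (n + 1), (a + k * b)) * Nat.lcmUpto (n + 1) *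
      b ^ (n + 1).factorial.factorization b :=
    Nat.mul_pos (Nat.mul_pos (prod_pos fun k _ ↦ by lia) (Nat.lcmUpto_pos _)) (pow_pos hb.pos _)
  refine Nat.le_of_mul_le_mul_right ?_ (n + 1).factorial_pos
  calc L a b n * (n + 1).factorial
      ≤ (∏ k ∈ range (n + 1), (a + k * b)) * Nat.lcmUpto (n + 1) *
        b ^ (n + 1).factorial.factorization b :=
        Nat.le_of_dvd hpos (L_mul_factorial_dvd ha hb hab n)
    _ ≤ (b ^ (n + 1) * (n + 1).factorial) * 4 ^ (n + 1) *
        b ^ (n + 1).factorial.factorization b := by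
        gcongr
        exact lcmUpto_le_four_pow _
    _ = _ := by ring

theorem four_mul_le_three_pow {n : ℕ} (hn : 3 ≤ n) : 4 * n ≤ 3 ^ n := by
  induction n, hn using Nat.le_induction with
  | base => norm_num
  | succ n hn ih => rw [pow_succ]; lia

theorem lcm_ap_upper_bound_prime (a b : ℕ) (ha : 0 < a) (hb : b.Prime)
    (hab : a < b) :
    ∀ n : ℕ, b + 1 ≤ n →
      (L a b n : ℝ) ≤ (12.30641 * (b : ℝ) ^ ((b : ℝ) / ((b : ℝ) - 1))) ^ n := by
  intro n hn
  have hb2 := hb.two_le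
  have hb1 : (0 : ℝ) < (b : ℝ) - 1 := by
    have : (2 : ℝ) ≤ b := by exact_mod_cast hb2
    linarith
  have hb0 : (0 : ℝ) < b := by linarith
  set v := (n + 1).factorial.factorization b with hv
  have hL : (L a b n : ℝ) ≤ (b : ℝ) ^ (n + 1) * 4 ^ (n + 1) * (b : ℝ) ^ v := by
    exact_mod_cast L_le ha hb hab n
  have hvn : (b - 1) * v ≤ n := by
    have : Fact b.Prime := ⟨hb⟩
    have := sub_one_mul_padicValNat_factorial_lt_of_ne_zero b (Nat.succ_ne_zero n)
    rw [← Nat.factorization_def _ hb] at this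
    exact Nat.lt_succ_iff.1 this
  have hvr : (v : ℝ) ≤ n / ((b : ℝ) - 1) := by
    rw [le_div_iff₀ hb1, mul_comm]
    have : (((b - 1 : ℕ) : ℝ)) * v ≤ n := by exact_mod_cast hvn
    rwa [Nat.cast_sub (by lia), Nat.cast_one] at this
  have hbv : (b : ℝ) ^ v ≤ (b : ℝ) ^ ((n : ℝ) / ((b : ℝ) - 1)) := by
    rw [← Real.rpow_natCast]
    exact Real.rpow_le_rpow_of_exponent_le (by linarith) hvr
  have hpow : ((b : ℝ) ^ ((b : ℝ) / ((b : ℝ) - 1))) ^ n =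
      (b : ℝ) ^ n * (b : ℝ) ^ ((n : ℝ) / ((b : ℝ) - 1)) := by
    rw [← Real.rpow_natCast, ← Real.rpow_mul hb0.le, ← Real.rpow_natCast (b : ℝ) n,
      ← Real.rpow_add hb0]
    congr 1
    field_simp
    ring
  have hconst : (b : ℝ) * 4 ^ (n + 1) ≤ 12.30641 ^ n := by
    have h3 : 4 * b ≤ 3 ^ n := (four_mul_le_three_pow (by lia : 3 ≤ n)).trans' (by lia)
    have h3' : 4 * (b : ℝ) ≤ 3 ^ n := by exact_mod_cast h3
    calc (b : ℝ) * 4 ^ (n + 1) = (4 * b) * 4 ^ n := by ring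
      _ ≤ 3 ^ n * 4 ^ n := by gcongr
      _ = 12 ^ n := by rw [← mul_pow]; norm_num
      _ ≤ 12.30641 ^ n := by gcongr; norm_num
  calc (L a b n : ℝ) ≤ (b : ℝ) ^ (n + 1) * 4 ^ (n + 1) * (b : ℝ) ^ v := hL
    _ = (b * 4 ^ (n + 1)) * ((b : ℝ) ^ n * (b : ℝ) ^ v) := by ring
    _ ≤ 12.30641 ^ n * ((b : ℝ) ^ n * (b : ℝ) ^ ((n : ℝ) / ((b : ℝ) - 1))) := by gcongr
    _ = _ := by rw [mul_pow, hpow]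
end

section
/- As r tends to infinity, M(r) is asymptotically equivalent to (log r)/r; that is, the limit of r · M(r) / log r as r → ∞ (over positive integers r) equals 1. -/
open Finset in
/-- `M n = (1/φ(n)) · Σ_{1 ≤ ℓ ≤ n, gcd(ℓ,n)=1} 1/ℓ`. -/
noncomputable def M (n : ℕ) : ℝ :=
  (1 / (Nat.totient n : ℝ)) *
    ∑ l ∈ (Finset.Icc 1 n).filter (fun l => Nat.gcd l n = 1), (1 : ℝ) / l

open Finset in
/-- The sum of `1/l` over the positive integers `l ≤ x` divisible by no element of `P`. -/
noncomputable def siftedHarmonic (x : ℝ) (P : Finset ℕ) : ℝ :=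
  ∑ l ∈ (Icc 1 ⌊x⌋₊).filter (fun l => ∀ p ∈ P, ¬ p ∣ l), (1 : ℝ) / l

theorem siftedHarmonic_empty (x : ℝ) : siftedHarmonic x ∅ = harmonic ⌊x⌋₊ := by
  simp [siftedHarmonic, harmonic_eq_sum_Icc]

open Finset in
theorem siftedHarmonic_insert (x : ℝ) {p : ℕ} {P : Finset ℕ} (hp : p.Prime)
    (hP : ∀ q ∈ P, q.Prime) (hpP : p ∉ P) :
    siftedHarmonic x (insert p P) = siftedHarmonic x P - 1 / p * siftedHarmonic (x / p) P := by
  have hdvd : 1 / (p : ℝ) * siftedHarmonic (x / p) P =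
      ∑ l ∈ ((Icc 1 ⌊x⌋₊).filter (fun l => ∀ q ∈ P, ¬ q ∣ l)).filter (fun l => p ∣ l),
        (1 : ℝ) / l := by
    rw [siftedHarmonic, mul_sum, Nat.floor_div_natCast]
    have hcop : ∀ q ∈ P, ∀ m : ℕ, q ∣ p * m ↔ q ∣ m := fun q hq m =>
      ((Nat.coprime_primes (hP q hq) hp).2 (fun h => hpP (h ▸ hq))).dvd_mul_left
    refine sum_bij (fun m _ => p * m) ?_ ?_ ?_ ?_
    · intro m hm
      simp only [mem_filter, mem_Icc] at hm ⊢
      refine ⟨⟨⟨Nat.mul_pos hp.pos hm.1.1, ?_⟩, fun q hq => ?_⟩, dvd_mul_right _ _⟩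
      · have := (Nat.le_div_iff_mul_le hp.pos).1 hm.1.2
        rwa [mul_comm]
      · rw [hcop q hq]
        exact hm.2 q hq
    · intro a _ b _ h
      exact Nat.eq_of_mul_eq_mul_left hp.pos h
    · intro l hl
      simp only [mem_filter, mem_Icc] at hl
      obtain ⟨⟨⟨h1, h2⟩, h3⟩, m, rfl⟩ := hl
      refine ⟨m, ?_, rfl⟩
      simp only [mem_filter, mem_Icc]
      refine ⟨⟨Nat.pos_of_mul_pos_left h1, ?_⟩, fun q hq => ?_⟩
      · rw [Nat.le_div_iff_mul_le hp.pos, mul_comm]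
        exact h2
      · rw [← hcop q hq]
        exact h3 q hq
    · intro m _
      push_cast
      rw [one_div_mul_one_div]
  rw [hdvd, eq_sub_iff_add_eq, siftedHarmonic, siftedHarmonic, add_comm,
    ← sum_filter_add_sum_filter_not ((Icc 1 ⌊x⌋₊).filter (fun l => ∀ q ∈ P, ¬ q ∣ l))
      (fun l => p ∣ l)]
  congr 2
  ext l
  simp only [mem_filter, mem_insert, forall_eq_or_imp]
  tauto

theorem abs_harmonic_floor_sub_log_le {x : ℝ} (hx : 0 < x) :
    |(harmonic ⌊x⌋₊ : ℝ) - (Real.log x + Real.eulerMascheroniConstant)| ≤ 2 / x := by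
  have hγ₁ := Real.one_half_lt_eulerMascheroniConstant
  have hγ₂ := Real.eulerMascheroniConstant_lt_two_thirds
  rcases lt_or_ge x 1 with h | h
  · have h1 : ⌊x⌋₊ = 0 := Nat.floor_eq_zero.2 h
    have h2 := Real.log_le_sub_one_of_pos (inv_pos.2 hx)
    rw [Real.log_inv] at h2
    have h3 : Real.log x ≤ 0 := Real.log_nonpos hx.le h.le
    have h4 : 1 < x⁻¹ := (one_lt_inv₀ hx).2 h
    rw [h1, div_eq_mul_inv, abs_le]
    simp only [harmonic_zero, Rat.cast_zero]
    constructor <;> linarith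
  · set n := ⌊x⌋₊ with hn
    have hn1 : 1 ≤ n := Nat.one_le_floor_iff x |>.2 h
    have hn1' : (1 : ℝ) ≤ n := by exact_mod_cast hn1
    have hnx : (n : ℝ) ≤ x := Nat.floor_le hx.le
    have hxn : x < n + 1 := Nat.lt_floor_add_one x
    have h1 := Real.eulerMascheroniSeq_lt_eulerMascheroniConstant n
    have h2 := Real.eulerMascheroniConstant_lt_eulerMascheroniSeq' n
    rw [Real.eulerMascheroniSeq] at h1
    rw [Real.eulerMascheroniSeq', if_neg (by omega)] at h2
    have h3 : Real.log n ≤ Real.log x := Real.log_le_log (by linarith) hnx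
    have h4 : Real.log x ≤ Real.log (n + 1) := Real.log_le_log hx hxn.le
    have h5 : Real.log (n + 1) - Real.log n ≤ 2 / x := by
      rw [← Real.log_div (by positivity) (by positivity)]
      refine (Real.log_le_sub_one_of_pos (by positivity)).trans ?_
      have h6 : ((n : ℝ) + 1) / n - 1 = 1 / n := by field_simp; ring
      rw [h6, div_le_div_iff₀ (by linarith) hx]
      linarith
    rw [abs_le]
    constructor <;> linarith

open Finset in
theorem abs_siftedHarmonic_sub_le (P : Finset ℕ) (hP : ∀ p ∈ P, p.Prime) {x : ℝ} (hx : 0 < x) :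
    |siftedHarmonic x P - (∏ p ∈ P, (1 - (p : ℝ)⁻¹)) *
      (Real.log x + Real.eulerMascheroniConstant + ∑ p ∈ P, Real.log p / (p - 1))| ≤
      2 ^ #P * (2 / x) := by
  induction P using Finset.induction_on generalizing x with
  | empty => simpa [siftedHarmonic_empty] using abs_harmonic_floor_sub_log_le hx
  | insert p P hpP ih =>
    have hp : p.Prime := hP p (mem_insert_self p P)
    have hP' : ∀ q ∈ P, q.Prime := fun q hq => hP q (mem_insert_of_mem hq)
    have hp1 : (1 : ℝ) < p := by exact_mod_cast hp.one_lt
    have hp0 : (0 : ℝ) < p := by linarith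
    have hp1' : (p : ℝ) - 1 ≠ 0 := by linarith
    have h1 := ih hP' hx
    have h2 := ih hP' (div_pos hx hp0)
    rw [Real.log_div hx.ne' hp0.ne'] at h2
    rw [siftedHarmonic_insert x hp hP' hpP, prod_insert hpP, sum_insert hpP,
      card_insert_of_notMem hpP]
    generalize siftedHarmonic x P = A at *
    generalize siftedHarmonic (x / p) P = B at *
    generalize (∏ p ∈ P, (1 - (p : ℝ)⁻¹)) = W at *
    generalize ∑ p ∈ P, Real.log p / ((p : ℝ) - 1) = S at *
    generalize Real.eulerMascheroniConstant = γ at *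
    have key : A - 1 / p * B - (1 - (p : ℝ)⁻¹) * W *
        (Real.log x + γ + (Real.log p / (p - 1) + S)) =
        (A - W * (Real.log x + γ + S)) -
          1 / p * (B - W * (Real.log x - Real.log p + γ + S)) := by
      field_simp
      ring
    rw [key]
    refine (abs_sub _ _).trans ?_
    rw [abs_mul, abs_of_pos (by positivity : 0 < 1 / (p : ℝ))]
    have h3 := mul_le_mul_of_nonneg_left h2 (by positivity : 0 ≤ 1 / (p : ℝ))
    have h4 : 1 / (p : ℝ) * (2 ^ #P * (2 / (x / p))) = 2 ^ #P * (2 / x) := by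
      field_simp
    rw [h4] at h3
    rw [pow_succ]
    linarith

open Finset in
theorem two_pow_card_primeFactors_le {n : ℕ} (hn : n ≠ 0) :
    2 ^ #n.primeFactors ≤ 2 * n.totient := by
  have h1 : ∏ p ∈ n.primeFactors, (p - 1) ≤ n.totient := by
    have h := Nat.totient_mul_prod_primeFactors n
    have hle : ∏ p ∈ n.primeFactors, p ≤ n :=
      Nat.le_of_dvd (Nat.pos_of_ne_zero hn) (Nat.prod_primeFactors_dvd n)
    refine Nat.le_of_mul_le_mul_left ?_ (Nat.pos_of_ne_zero hn)
    rw [← h, mul_comm n]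
    exact Nat.mul_le_mul_left _ hle
  have h2 : ∏ p ∈ n.primeFactors.erase 2, (p - 1) = ∏ p ∈ n.primeFactors, (p - 1) :=
    prod_erase _ rfl
  have h3 : 2 ^ #(n.primeFactors.erase 2) ≤ ∏ p ∈ n.primeFactors.erase 2, (p - 1) := by
    refine pow_card_le_prod _ _ _ fun p hp => ?_
    have h5 := (Nat.prime_of_mem_primeFactors (mem_of_mem_erase hp)).two_le
    have h6 := ne_of_mem_erase hp
    omega
  have h4 : 2 ^ #n.primeFactors ≤ 2 ^ (#(n.primeFactors.erase 2) + 1) :=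
    Nat.pow_le_pow_right two_pos <| by
      have := pred_card_le_card_erase (s := n.primeFactors) (a := 2)
      omega
  rw [pow_succ] at h4
  omega

theorem siftedHarmonic_primeFactors {n : ℕ} (hn : n ≠ 0) :
    siftedHarmonic n n.primeFactors =
      ∑ l ∈ (Finset.Icc 1 n).filter (fun l => Nat.gcd l n = 1), (1 : ℝ) / l := by
  rw [siftedHarmonic, Nat.floor_natCast]
  congr 1
  refine Finset.filter_congr fun l _ => ?_
  change _ ↔ Nat.Coprime l n
  constructor
  · intro h
    refine Nat.coprime_of_dvd fun p hp hpl hpn => ?_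
    exact h p (Nat.mem_primeFactors.2 ⟨hp, hpn, hn⟩) hpl
  · intro h p hp hpl
    exact (Nat.prime_of_mem_primeFactors hp).one_lt.ne'
      (Nat.eq_one_of_dvd_coprimes h hpl (Nat.dvd_of_mem_primeFactors hp))

theorem abs_mul_M_sub_log_le {n : ℕ} (hn : n ≠ 0) :
    |n * M n - Real.log n| ≤ 5 + ∑ p ∈ n.primeFactors, Real.log p / ((p : ℝ) - 1) := by
  have hn0 : (0 : ℝ) < n := by exact_mod_cast Nat.pos_of_ne_zero hn
  have hφ : (0 : ℝ) < n.totient := by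
    exact_mod_cast Nat.totient_pos.2 (Nat.pos_of_ne_zero hn)
  have h := abs_siftedHarmonic_sub_le n.primeFactors
    (fun p hp => Nat.prime_of_mem_primeFactors hp) hn0
  have hW : (n.totient : ℝ) = n * ∏ p ∈ n.primeFactors, (1 - (p : ℝ)⁻¹) := by
    have h := congrArg (Rat.cast : ℚ → ℝ) (Nat.totient_eq_mul_prod_factors n)
    push_cast at h
    exact h
  have h2 : (2 : ℝ) ^ n.primeFactors.card ≤ 2 * n.totient := by
    exact_mod_cast two_pow_card_primeFactors_le hn
  have hS : 0 ≤ ∑ p ∈ n.primeFactors, Real.log p / ((p : ℝ) - 1) :=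
    Finset.sum_nonneg fun p hp => by
      have h1 : (1 : ℝ) ≤ p := by
        exact_mod_cast (Nat.prime_of_mem_primeFactors hp).one_le
      exact div_nonneg (Real.log_nonneg h1) (by linarith)
  have hγ₁ := Real.one_half_lt_eulerMascheroniConstant
  have hγ₂ := Real.eulerMascheroniConstant_lt_two_thirds
  rw [M, ← siftedHarmonic_primeFactors hn]
  generalize siftedHarmonic n n.primeFactors = A at *
  generalize (∏ p ∈ n.primeFactors, (1 - (p : ℝ)⁻¹)) = W at *
  generalize ∑ p ∈ n.primeFactors, Real.log p / ((p : ℝ) - 1) = S at *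
  generalize Real.eulerMascheroniConstant = γ at *
  have hW' : W = n.totient / n := by rw [hW]; field_simp
  have h3 : (n : ℝ) * (1 / n.totient * A) - (Real.log n + γ + S) =
      n / n.totient * (A - W * (Real.log n + γ + S)) := by
    rw [hW']
    field_simp
  have h4 : |(n : ℝ) * (1 / n.totient * A) - (Real.log n + γ + S)| ≤ 4 := by
    rw [h3, abs_mul, abs_of_pos (by positivity)]
    calc (n : ℝ) / n.totient * |A - W * (Real.log n + γ + S)|
        ≤ n / n.totient * (2 * n.totient * (2 / n)) := by
          gcongr
          exact h.trans (by gcongr)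
      _ = 4 := by field_simp; norm_num
  rw [abs_le] at h4 ⊢
  constructor <;> linarith [h4.1, h4.2]

open Finset in
theorem exists_sum_primeFactors_log_div_le {ε : ℝ} (hε : 0 < ε) :
    ∃ C : ℝ, ∀ n : ℕ, n ≠ 0 →
      ∑ p ∈ n.primeFactors, Real.log p / ((p : ℝ) - 1) ≤ C + ε * Real.log n := by
  obtain ⟨K, hK⟩ := exists_nat_gt (1 / ε + 1)
  refine ⟨∑ p ∈ range K, |Real.log p / ((p : ℝ) - 1)|, fun n hn => ?_⟩
  have hlog : ∑ p ∈ n.primeFactors, Real.log p ≤ Real.log n := by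
    rw [← Real.log_prod fun p hp =>
      Nat.cast_ne_zero.2 (Nat.prime_of_mem_primeFactors hp).ne_zero, ← Nat.cast_prod]
    refine Real.log_le_log ?_ ?_
    · exact_mod_cast prod_pos fun p hp => (Nat.prime_of_mem_primeFactors hp).pos
    · exact_mod_cast Nat.le_of_dvd (Nat.pos_of_ne_zero hn) (Nat.prod_primeFactors_dvd n)
  rw [← sum_filter_add_sum_filter_not n.primeFactors (fun p => p < K)]
  refine add_le_add ?_ ?_
  · calc _ ≤ ∑ p ∈ n.primeFactors with p < K, |Real.log p / ((p : ℝ) - 1)| :=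
          sum_le_sum fun p _ => le_abs_self _
      _ ≤ _ := sum_le_sum_of_subset_of_nonneg
          (fun p hp => mem_range.2 (mem_filter.1 hp).2) fun p _ _ => abs_nonneg _
  · calc _ ≤ ∑ p ∈ n.primeFactors with ¬ p < K, ε * Real.log p := by
          refine sum_le_sum fun p hp => ?_
          have hKp : (K : ℝ) ≤ p := by exact_mod_cast not_lt.1 (mem_filter.1 hp).2
          have h1 : 1 / ε < (p : ℝ) - 1 := by linarith
          have h2 : 0 < 1 / ε := by positivity
          have h3 : 1 < ((p : ℝ) - 1) * ε := (div_lt_iff₀ hε).1 h1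
          have h4 : 0 ≤ Real.log p := Real.log_nonneg (by linarith)
          rw [div_le_iff₀ (by linarith)]
          nlinarith
      _ ≤ ∑ p ∈ n.primeFactors, ε * Real.log p :=
          sum_le_sum_of_subset_of_nonneg (filter_subset _ _) fun p _ _ =>
            mul_nonneg hε.le (Real.log_natCast_nonneg p)
      _ ≤ ε * Real.log n := by
          rw [← mul_sum]
          exact mul_le_mul_of_nonneg_left hlog hε.le

theorem M_asymptotic :
    Filter.Tendsto (fun r : ℕ => (r : ℝ) * M r / Real.log r)
      Filter.atTop (nhds 1) := by
  rw [Metric.tendsto_nhds]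
  intro ε hε
  obtain ⟨C, hC⟩ := exists_sum_primeFactors_log_div_le (half_pos hε)
  have hlim : Filter.Tendsto (fun r : ℕ => Real.log r) Filter.atTop Filter.atTop :=
    Real.tendsto_log_atTop.comp tendsto_natCast_atTop_atTop
  filter_upwards [hlim.eventually_gt_atTop 0, hlim.eventually_gt_atTop ((5 + C) / (ε / 2)),
    Filter.eventually_ne_atTop 0] with r hr hr' hr0
  have h1 := abs_mul_M_sub_log_le hr0
  have h2 := hC r hr0
  rw [div_lt_iff₀ (half_pos hε)] at hr'
  rw [Real.dist_eq, div_sub_one hr.ne', abs_div, abs_of_pos hr, div_lt_iff₀ hr]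
  linarith
end

section
/- Let b ≥ 2 and n ≥ 2 be integers. Then ∏_{p prime, p ∣ b} p^(ϑ_p(n!)) ≤ (3.35609 · log b)^n. -/
section PrimeSums

open Finset Real

theorem factorization_factorial_le_div {p : ℕ} (hp : p.Prime) (n : ℕ) :
    ((n.factorial.factorization p : ℕ) : ℝ) ≤ n / ((p : ℝ) - 1) := by
  have := Fact.mk hp
  have h := sub_one_mul_padicValNat_factorial (p := p) n
  have h2 : (p - 1) * n.factorial.factorization p ≤ n := by
    rw [Nat.factorization_def _ hp, h]; exact Nat.sub_le _ _
  have hp2 : (2 : ℝ) ≤ p := by exact_mod_cast hp.two_le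
  rw [le_div_iff₀ (by linarith)]
  have h3 : (((p - 1) * n.factorial.factorization p : ℕ) : ℝ) ≤ n := by exact_mod_cast h2
  rw [Nat.cast_mul, Nat.cast_sub hp.one_le, Nat.cast_one] at h3
  linarith

theorem div_sub_one_le_factorization_factorial {p : ℕ} (hp : p.Prime) (m : ℕ) :
    (m : ℝ) / p - 1 ≤ (m.factorial.factorization p : ℕ) := by
  have h : m / p ≤ m.factorial.factorization p := by
    rw [← hp.pow_dvd_iff_le_factorization m.factorial_ne_zero]
    have h1 : p ^ (m / p) ∣ (p * (m / p)).factorial := by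
      rw [Nat.Prime.pow_dvd_iff_le_factorization hp (Nat.factorial_ne_zero _),
        Nat.factorization_factorial_mul hp]
      exact Nat.le_add_left _ _
    exact h1.trans (Nat.factorial_dvd_factorial (Nat.mul_div_le m p))
  have h2 : (m : ℝ) / p < (m / p : ℕ) + 1 := by
    rw [div_lt_iff₀ (by exact_mod_cast hp.pos)]
    exact_mod_cast (by rw [mul_comm]; exact Nat.lt_mul_div_succ m hp.pos)
  have h3 : ((m / p : ℕ) : ℝ) ≤ (m.factorial.factorization p : ℕ) := by exact_mod_cast h
  linarith

theorem log_factorial_eq_sum_primes (m : ℕ) :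
    log m.factorial =
      ∑ p ∈ (range (m + 1)).filter Nat.Prime, (m.factorial.factorization p : ℝ) * log p := by
  conv_lhs => rw [← Nat.prod_factorization_pow_eq_self m.factorial_ne_zero]
  rw [Nat.prod_factorization_eq_prod_primeFactors, Nat.cast_prod, log_prod]
  · refine sum_congr ?_ fun p _ => by rw [Nat.cast_pow, log_pow]
    ext p
    simp only [Nat.mem_primeFactors, mem_filter, mem_range]
    constructor
    · rintro ⟨hp, hd, _⟩
      exact ⟨Nat.lt_succ_of_le (hp.dvd_factorial.1 hd), hp⟩
    · rintro ⟨hm, hp⟩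
      exact ⟨hp, hp.dvd_factorial.2 (Nat.le_of_lt_succ hm), m.factorial_ne_zero⟩
  · intro p hp
    have := (Nat.prime_of_mem_primeFactors hp).pos
    positivity

theorem log_factorial_le {m : ℕ} (hm : 1 ≤ m) :
    log m.factorial ≤ m * log m - m + log m / 2 + 1 := by
  obtain ⟨k, rfl⟩ := Nat.exists_eq_add_of_le' hm
  have h := Stirling.log_stirlingSeq'_antitone (Nat.zero_le k)
  simp only [Function.comp_apply, Stirling.log_stirlingSeq_formula, Nat.succ_eq_add_one] at h
  have hk : ((k + 1 : ℕ) : ℝ) ≠ 0 := by positivity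
  rw [log_div hk (exp_ne_zero _), log_mul two_ne_zero hk] at h
  simp only [log_exp, zero_add, Nat.factorial_one, Nat.cast_one, log_one, mul_one, one_div,
    log_inv] at h
  linarith

theorem sum_primeFactors_log_div_le {b m : ℕ} (hb : b ≠ 0) (hm : 1 ≤ m) :
    ∑ p ∈ b.primeFactors, log p / ((p : ℝ) - 1) ≤
      ∑ p ∈ (range (m + 1)).filter Nat.Prime, log p * (1 / ((p : ℝ) - 1) - 1 / m) +
        log b / m := by
  have hm0 : (0 : ℝ) < m := by exact_mod_cast hm
  have hlog : ∑ p ∈ b.primeFactors, log p ≤ log b := by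
    rw [← log_prod fun p hp => by
      have := (Nat.prime_of_mem_primeFactors hp).pos
      positivity]
    apply log_le_log
    · exact prod_pos fun p hp => by
        have := (Nat.prime_of_mem_primeFactors hp).pos
        positivity
    · rw [← Nat.cast_prod]
      exact_mod_cast Nat.le_of_dvd (Nat.pos_of_ne_zero hb) (Nat.prod_primeFactors_dvd b)
  have hsplit : ∑ p ∈ b.primeFactors, log p / ((p : ℝ) - 1) =
      ∑ p ∈ b.primeFactors, log p * (1 / ((p : ℝ) - 1) - 1 / m) +
        (∑ p ∈ b.primeFactors, log p) / m := by
    rw [sum_div, ← sum_add_distrib]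
    exact sum_congr rfl fun p _ => by ring
  rw [hsplit]
  refine add_le_add ?_ (by gcongr)
  calc ∑ p ∈ b.primeFactors, log p * (1 / ((p : ℝ) - 1) - 1 / m)
      ≤ ∑ p ∈ b.primeFactors with p < m + 1, log p * (1 / ((p : ℝ) - 1) - 1 / m) := by
        rw [sum_filter]
        refine sum_le_sum fun p hp => ?_
        split_ifs with h
        · exact le_rfl
        · have hpm : (m : ℝ) + 1 ≤ p := by exact_mod_cast not_lt.1 h
          refine mul_nonpos_of_nonneg_of_nonpos (log_natCast_nonneg p) (sub_nonpos.2 ?_)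
          exact one_div_le_one_div_of_le hm0 (by linarith)
    _ ≤ _ := by
        refine sum_le_sum_of_subset_of_nonneg ?_ ?_
        · intro p hp
          simp only [mem_filter, mem_range] at hp ⊢
          exact ⟨hp.2, Nat.prime_of_mem_primeFactors hp.1⟩
        · intro p hp _
          simp only [mem_filter, mem_range] at hp
          have hp2 : (2 : ℝ) ≤ p := by exact_mod_cast hp.2.two_le
          have hpm : (p : ℝ) ≤ m := by exact_mod_cast Nat.le_of_lt_succ hp.1
          refine mul_nonneg (log_natCast_nonneg p) (sub_nonneg.2 ?_)
          exact one_div_le_one_div_of_le (by linarith) (by linarith)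

theorem log_le_of_pow_le_two_pow {x : ℝ} (hx : 0 < x) {j k : ℕ} (hj : 0 < j)
    (h : x ^ j ≤ 2 ^ k) : log x ≤ k / j * log 2 := by
  have := log_le_log (by positivity) h
  rw [log_pow, log_pow] at this
  rw [div_mul_eq_mul_div, le_div_iff₀ (by positivity)]
  linarith

theorem log_ge_of_two_pow_le_pow {x : ℝ} {j k : ℕ} (hj : 0 < j)
    (h : 2 ^ k ≤ x ^ j) : k / j * log 2 ≤ log x := by
  have := log_le_log (by positivity) h
  rw [log_pow, log_pow] at this
  rw [div_mul_eq_mul_div, div_le_iff₀ (by positivity)]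
  linarith

theorem log_three_le : log 3 ≤ 1.1091 := by
  have := log_le_of_pow_le_two_pow (x := 3) (j := 5) (k := 8) (by norm_num) (by norm_num)
    (by norm_num)
  have := log_two_lt_d9
  norm_num at *; linarith

theorem log_five_le : log 5 ≤ 1.6175 := by
  have := log_le_of_pow_le_two_pow (x := 5) (j := 3) (k := 7) (by norm_num) (by norm_num)
    (by norm_num)
  have := log_two_lt_d9
  norm_num at *; linarith

theorem log_seven_le : log 7 ≤ 1.9641 := by
  have := log_le_of_pow_le_two_pow (x := 7) (j := 6) (k := 17) (by norm_num) (by norm_num)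
    (by norm_num)
  have := log_two_lt_d9
  norm_num at *; linarith

theorem log_eleven_le : log 11 ≤ 2.4261 := by
  have := log_le_of_pow_le_two_pow (x := 11) (j := 2) (k := 7) (by norm_num) (by norm_num)
    (by norm_num)
  have := log_two_lt_d9
  norm_num at *; linarith

theorem le_log_ten : 2.2527 ≤ log 10 := by
  have := log_ge_of_two_pow_le_pow (x := 10) (j := 4) (k := 13) (by norm_num) (by norm_num)
  have := log_two_gt_d9
  norm_num at *; linarith

theorem le_log_const : 1.1882 ≤ log 3.35609 := by
  have := log_ge_of_two_pow_le_pow (x := 3.35609) (j := 7) (k := 12) (by norm_num) (by norm_num)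
  have := log_two_gt_d9
  norm_num at *; linarith

theorem sum_primes_log_div_mul_sub_one_le {m : ℕ} (hm : 11 ≤ m) :
    ∑ p ∈ (range (m + 1)).filter Nat.Prime, log p / ((p : ℝ) * (p - 1)) ≤
      1.01 - (log m + 12 / 11) / m := by
  induction m, hm using Nat.le_induction with
  | base =>
    rw [show (range (11 + 1)).filter Nat.Prime = {2, 3, 5, 7, 11} by decide]
    have := log_two_lt_d9
    have := log_three_le
    have := log_five_le
    have := log_seven_le
    have := log_eleven_le
    norm_num at *
    linarith
  | succ m hm ih =>
    have hm' : (11 : ℝ) ≤ m := by exact_mod_cast hm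
    have hm0 : (0 : ℝ) < m := by linarith
    have hlog : log ((m : ℝ) + 1) ≤ log m + 1 / m := by
      have h := log_le_sub_one_of_pos (x := ((m : ℝ) + 1) / m) (by positivity)
      rw [log_div (by positivity) (by positivity)] at h
      have : ((m : ℝ) + 1) / m - 1 = 1 / m := by field_simp; ring
      linarith
    have hstep : ∑ p ∈ (range (m + 1 + 1)).filter Nat.Prime, log p / ((p : ℝ) * (p - 1)) ≤
        ∑ p ∈ (range (m + 1)).filter Nat.Prime, log p / ((p : ℝ) * (p - 1)) +
          log ((m : ℝ) + 1) / ((m + 1) * m) := by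
      rw [range_add_one (n := m + 1), filter_insert]
      split_ifs with h
      · rw [sum_insert (by simp), add_comm]
        push_cast
        simp
      · have : 0 ≤ log ((m : ℝ) + 1) := log_nonneg (by linarith)
        have : 0 ≤ log ((m : ℝ) + 1) / ((m + 1) * m) := by positivity
        linarith
    have hkey : log ((m : ℝ) + 1) / ((m + 1) * m) + (log ((m : ℝ) + 1) + 12 / 11) / (m + 1) ≤
        (log m + 12 / 11) / m := by
      have e : log ((m : ℝ) + 1) / ((m + 1) * m) + (log ((m : ℝ) + 1) + 12 / 11) / (m + 1) =
          (log ((m : ℝ) + 1) + 12 / 11 * (1 - 1 / (m + 1))) / m := by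
        field_simp; ring
      rw [e]
      gcongr ?_ / _
      have : 1 / (m : ℝ) ≤ 12 / 11 * (1 / (m + 1)) := by
        rw [div_mul_div_comm, div_le_div_iff₀ (by positivity) (by positivity)]
        linarith
      linarith
    push_cast
    linarith

theorem sum_primeFactors_log_div_le_log_of_large {b : ℕ} (hL : 25 ≤ log b) :
    ∑ p ∈ b.primeFactors, log p / ((p : ℝ) - 1) ≤ log (3.35609 * log b) := by
  have hb : b ≠ 0 := by rintro rfl; norm_num at hL
  set L := log b with hLdef
  set m := ⌊L⌋₊ with hmdef
  have hm25 : 25 ≤ m := Nat.le_floor (by exact_mod_cast hL)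
  have hm25' : (25 : ℝ) ≤ m := by exact_mod_cast hm25
  have hm0 : (0 : ℝ) < m := by linarith
  have hmL : (m : ℝ) ≤ L := Nat.floor_le (by linarith)
  have hLm : L < m + 1 := Nat.lt_floor_add_one L
  refine (sum_primeFactors_log_div_le hb (m := m) (by lia)).trans ?_
  rw [← hLdef]
  have h1 : ∑ p ∈ (range (m + 1)).filter Nat.Prime, log p * (1 / ((p : ℝ) - 1) - 1 / m) ≤
      log m.factorial / m +
        ∑ p ∈ (range (m + 1)).filter Nat.Prime, log p / ((p : ℝ) * (p - 1)) := by
    rw [log_factorial_eq_sum_primes, sum_div, ← sum_add_distrib]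
    refine sum_le_sum fun p hp => ?_
    have hp' := (mem_filter.1 hp).2
    have hp2 : (2 : ℝ) ≤ p := by exact_mod_cast hp'.two_le
    have h := div_sub_one_le_factorization_factorial hp' m
    have hl : 0 ≤ log (p : ℝ) := log_natCast_nonneg p
    have hp1 : (p : ℝ) - 1 ≠ 0 := by linarith
    have e : log (p : ℝ) * (1 / ((p : ℝ) - 1) - 1 / m) =
        (m / p - 1) * log p / m + log p / ((p : ℝ) * (p - 1)) := by
      field_simp; ring
    rw [e]
    gcongr
  have h2 := sum_primes_log_div_mul_sub_one_le (m := m) (by lia)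
  have h3 : log m.factorial / m ≤ log m - 1 + (log m / 2 + 1) / m := by
    rw [div_le_iff₀ hm0]
    have h := log_factorial_le (m := m) (by lia)
    have e : (log m - 1 + (log m / 2 + 1) / m) * m = m * log m - m + log m / 2 + 1 := by
      field_simp; ring
    linarith
  have h4 : L / m ≤ 1 + 1 / m := by
    rw [div_le_iff₀ hm0]
    have e : (1 + 1 / (m : ℝ)) * m = m + 1 := by field_simp
    linarith
  have h5 : log m ≤ log L := log_le_log hm0 hmL
  have h6 : 0 ≤ log (m : ℝ) := log_natCast_nonneg m
  have h7 : (log m / 2 + 1) / m + 1 / m - (log m + 12 / 11) / m ≤ 1 / m := by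
    rw [← add_div, ← sub_div]
    gcongr
    linarith
  have h8 : 1 / (m : ℝ) ≤ 1 / 25 := one_div_le_one_div_of_le (by norm_num) hm25'
  have h9 := le_log_const
  rw [log_mul (by norm_num) (by linarith)]
  linarith

theorem log_const_mul_ge {L a : ℝ} (hL : 0 < L) (ha : 0 < a) :
    1.1882 + log a + 1 - a / L ≤ log (3.35609 * L) := by
  have h := log_le_sub_one_of_pos (x := a / L) (by positivity)
  rw [log_div ha.ne' hL.ne'] at h
  rw [log_mul (by norm_num) hL.ne']
  linarith [le_log_const]

theorem sum_primeFactors_log_div_le_log {b : ℕ} (hb : 2 ≤ b) :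
    ∑ p ∈ b.primeFactors, log p / ((p : ℝ) - 1) ≤ log (3.35609 * log b) := by
  have hb0 : b ≠ 0 := by lia
  have hl2 := log_two_gt_d9
  have hu2 := log_two_lt_d9
  have hL2 : log 2 ≤ log b := log_le_log (by norm_num) (by exact_mod_cast hb)
  have hL0 : 0 < log b := by linarith
  rcases le_total 25 (log b) with h | h
  · exact sum_primeFactors_log_div_le_log_of_large h
  rcases le_total 4 (log b) with h4 | h4
  · refine (sum_primeFactors_log_div_le hb0 (m := 10) (by norm_num)).trans ?_
    refine le_trans ?_ (log_const_mul_ge hL0 (a := 10) (by norm_num))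
    rw [show (range (10 + 1)).filter Nat.Prime = {2, 3, 5, 7} by decide]
    have hq : 10 / log b ≤ 2.9 - log b / 10 := by
      rw [div_le_iff₀ hL0]; nlinarith
    have := log_three_le
    have := log_five_le
    have := log_seven_le
    have := le_log_ten
    norm_num at *
    linarith
  rcases le_total 1.25 (log b) with h1 | h1
  · refine (sum_primeFactors_log_div_le hb0 (m := 2) (by norm_num)).trans ?_
    refine le_trans ?_ (log_const_mul_ge hL0 (a := 2) (by norm_num))
    rw [show (range (2 + 1)).filter Nat.Prime = {2} by decide]
    have hq : 2 / log b ≤ 2.5 - log b / 2 := by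
      rw [div_le_iff₀ hL0]; nlinarith
    norm_num at *
    linarith
  · refine (sum_primeFactors_log_div_le hb0 (m := 1) (by norm_num)).trans ?_
    refine le_trans ?_ (log_const_mul_ge hL0 (a := 1) (by norm_num))
    rw [show (range (1 + 1)).filter Nat.Prime = ∅ by decide]
    have hq : 1 / log b ≤ 2.14 - log b := by
      rw [div_le_iff₀ hL0]; nlinarith
    norm_num at *
    linarith

end PrimeSums

open Finset in
theorem prod_prime_pow_factorial_bound (b n : ℕ) (hb : 2 ≤ b) (hn : 2 ≤ n) :
    ((∏ p ∈ b.primeFactors, p ^ ((n.factorial).factorization p) : ℕ) : ℝ) ≤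
      (3.35609 * Real.log b) ^ n := by
  have hL0 : 0 < Real.log b := Real.log_pos (by exact_mod_cast hb)
  have hpos : ∀ p ∈ b.primeFactors, (0 : ℝ) < (p : ℝ) ^ n.factorial.factorization p :=
    fun p hp => by
      have := (Nat.prime_of_mem_primeFactors hp).pos
      positivity
  push_cast
  rw [← Real.log_le_log_iff (prod_pos hpos) (by positivity), Real.log_pow,
    Real.log_prod fun p hp => (hpos p hp).ne']
  calc ∑ p ∈ b.primeFactors, Real.log ((p : ℝ) ^ n.factorial.factorization p)
      ≤ ∑ p ∈ b.primeFactors, n * (Real.log p / ((p : ℝ) - 1)) := by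
        refine sum_le_sum fun p hp => ?_
        rw [Real.log_pow, mul_div_left_comm, mul_comm]
        exact mul_le_mul_of_nonneg_left
          (factorization_factorial_le_div (Nat.prime_of_mem_primeFactors hp) n)
          (Real.log_natCast_nonneg p)
    _ ≤ n * Real.log (3.35609 * Real.log b) := by
        rw [← mul_sum]
        gcongr
        exact sum_primeFactors_log_div_le_log hb
end
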